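/- arXiv:2109.10545 — 2 statements merged into one kernel-verified Lean document; each statement's English description precedes it below -/
import Mathlib

section
/- Let H₀ be a bounded self-adjoint operator on a complex Hilbert space 𝓗, F : 𝓗 →L[ℂ] 𝓚 a compact operator into a complex Hilbert space 𝓚, λ ∈ ℝ, and J a bounded self-adjoint operator on 𝓚. If the direction V = F* J F is λ-regular for H₀ (i.e., there exists r ∈ ℝ such that T_{λ+i0}(H₀ + r F* J F) exists in norm), then the direction F* |J| F is also λ-regular for H₀, where |J| = √(J²) is the absolute value of J given by the continuous functional calculus. -/
open ContinuousLinearMap Filter Complex Set Topology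

variable {𝓗 𝓚 : Type*} [NormedAddCommGroup 𝓗] [InnerProductSpace ℂ 𝓗] [CompleteSpace 𝓗]
  [NormedAddCommGroup 𝓚] [InnerProductSpace ℂ 𝓚] [CompleteSpace 𝓚]

/-- `Tz F A z = F (A - z)⁻¹ F*`, using `Ring.inverse` (which is the genuine inverse when
`A - z•1` is invertible, as is the case for self-adjoint `A` and nonreal `z`). -/
noncomputable def Tz (F : 𝓗 →L[ℂ] 𝓚) (A : 𝓗 →L[ℂ] 𝓗) (z : ℂ) : 𝓚 →L[ℂ] 𝓚 :=
  F ∘L (Ring.inverse (A - z • (1 : 𝓗 →L[ℂ] 𝓗))) ∘L (adjoint F)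

/-- The norm limit `T_{λ+i0}(A)` exists: there is a bounded operator `T` on `𝓚` such that
`T_{λ+iy}(A) → T` in operator norm as `y → 0⁺`. -/
def NormLimitExists (F : 𝓗 →L[ℂ] 𝓚) (A : 𝓗 →L[ℂ] 𝓗) (lam : ℝ) : Prop :=
  ∃ T : 𝓚 →L[ℂ] 𝓚,
    Tendsto (fun y : ℝ => Tz F A ((lam : ℂ) + y * Complex.I)) (𝓝[>] 0) (𝓝 T)

/-- The direction `F* J F` is `λ`-regular for `H₀`: for some `r ∈ ℝ` the norm limit
`T_{λ+i0}(H₀ + r F* J F)` exists. -/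
def IsRegularDirection (F : 𝓗 →L[ℂ] 𝓚) (H₀ : 𝓗 →L[ℂ] 𝓗) (lam : ℝ) (J : 𝓚 →L[ℂ] 𝓚) : Prop :=
  ∃ r : ℝ, NormLimitExists F (H₀ + (r : ℂ) • ((adjoint F) ∘L J ∘L F)) lam

open Module in
theorem aux_eigen (C : 𝓚 →L[ℂ] 𝓚) (hC : IsCompactOperator C) (μ : ℕ → ℂ)
    (hμ : Function.Injective μ) (v : ℕ → 𝓚) (hv : ∀ n, v n ≠ 0) (hCv : ∀ n, C (v n) = μ n • v n)
    (c : ℝ) (hc : 0 < c) (hcμ : ∀ n, c ≤ ‖μ n‖) : False := by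
  have hli : LinearIndependent ℂ v := by
    refine Module.End.eigenvectors_linearIndependent' (C : End ℂ 𝓚) μ hμ v (fun n => ?_)
    rw [Module.End.hasEigenvector_iff, Module.End.mem_eigenspace_iff]
    exact ⟨hCv n, hv n⟩
  set x := InnerProductSpace.gramSchmidtNormed ℂ v with hx
  have hxn : ∀ n, ‖x n‖ = 1 := fun n => InnerProductSpace.gramSchmidtNormed_unit_length n hli
  have hperp : ∀ n, ∀ w ∈ Submodule.span ℂ (v '' Set.Iio n), inner ℂ (x n) w = 0 := by
    intro n w hw
    induction hw using Submodule.span_induction with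
    | mem y hy =>
      obtain ⟨i, hi, rfl⟩ := hy
      rw [hx, InnerProductSpace.gramSchmidtNormed, inner_smul_left,
        InnerProductSpace.gramSchmidt_inv_triangular ℂ v hi, mul_zero]
    | zero => simp
    | add y z _ _ h1 h2 => rw [inner_add_right, h1, h2, add_zero]
    | smul a y _ h => rw [inner_smul_right, h, mul_zero]
  have hxs : ∀ n, x n ∈ Submodule.span ℂ (v '' Set.Iic n) := fun n =>
    Submodule.smul_mem _ _ (InnerProductSpace.gramSchmidt_mem_span ℂ v le_rfl)
  have hstep : ∀ n, ∀ w ∈ Submodule.span ℂ (v '' Set.Iic n),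
      C w - μ n • w ∈ Submodule.span ℂ (v '' Set.Iio n) := by
    intro n w hw
    induction hw using Submodule.span_induction with
    | mem y hy =>
      obtain ⟨i, hi, rfl⟩ := hy
      rw [hCv, ← sub_smul]
      rcases (show i ≤ n from hi).lt_or_eq with h | h
      · exact Submodule.smul_mem _ _ (Submodule.subset_span ⟨i, h, rfl⟩)
      · simp [h]
    | zero => simp
    | add y z _ _ h1 h2 =>
      have := Submodule.add_mem _ h1 h2
      rw [map_add, smul_add]
      convert this using 1
      abel
    | smul a y _ h =>
      have := Submodule.smul_mem _ a h
      rw [map_smul, smul_comm, ← smul_sub]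
      exact this
  have hlow : ∀ m n, m < n → c ≤ ‖C (x n) - C (x m)‖ := by
    intro m n hmn
    have hle : Submodule.span ℂ (v '' Set.Iic m) ≤ Submodule.span ℂ (v '' Set.Iio n) :=
      Submodule.span_mono (Set.image_mono (Set.Iic_subset_Iio.2 hmn))
    have hle' : Submodule.span ℂ (v '' Set.Iio m) ≤ Submodule.span ℂ (v '' Set.Iio n) :=
      Submodule.span_mono (Set.image_mono (Set.Iio_subset_Iio hmn.le))
    have h1 := hperp n _ (hstep n _ (hxs n))
    have h2 := hperp n _ (hle' (hstep m _ (hxs m)))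
    have h3 := hperp n _ (hle (hxs m))
    rw [inner_sub_right, inner_smul_right] at h1 h2
    rw [h3, mul_zero, sub_zero] at h2
    have h4 : inner ℂ (x n) (x n) = (1 : ℂ) := by
      rw [inner_self_eq_norm_sq_to_K, hxn]; simp
    rw [h4, mul_one, sub_eq_zero] at h1
    have h5 : inner ℂ (x n) (C (x n) - C (x m)) = μ n := by rw [inner_sub_right, h1, h2, sub_zero]
    have h6 := norm_inner_le_norm (𝕜 := ℂ) (x n) (C (x n) - C (x m))
    rw [h5, hxn, one_mul] at h6
    exact (hcμ n).trans h6
  obtain ⟨K, hK, hK'⟩ := hC.image_closedBall_subset_compact (f := (C : 𝓚 →ₗ[ℂ] 𝓚)) 1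
  obtain ⟨y, hyK, ψ, hψ, hψy⟩ := hK.tendsto_subseq (x := fun n => C (x n))
    (fun n ↦ hK' ⟨x n, by simp [hxn], rfl⟩)
  replace hψy := hψy.cauchySeq
  rw [Metric.cauchySeq_iff'] at hψy
  obtain ⟨N, hN⟩ := hψy c hc
  have h := hN (N + 1) (by simp)
  rw [dist_eq_norm] at h
  exact absurd (hlow _ _ (hψ (Nat.lt_succ_self N))) (not_le.2 h)

theorem aux_fredholm (C : 𝓚 →L[ℂ] 𝓚) (hC : IsCompactOperator C)
    (h : ¬ IsUnit (1 + C)) : ∃ φ : 𝓚, φ ≠ 0 ∧ C φ = -φ := by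
  rcases hC.hasEigenvalue_or_mem_resolventSet (μ := (-1 : ℂ)) (by simp) with h1 | h1
  · obtain ⟨φ, hφ⟩ := h1.exists_hasEigenvector
    refine ⟨φ, hφ.2, ?_⟩
    have := hφ.apply_eq_smul
    simpa using this
  · exfalso
    apply h
    rw [spectrum.mem_resolventSet_iff, ← IsUnit.neg_iff] at h1
    convert h1 using 1
    simp [add_comm]

theorem aux_unit (A : 𝓗 →L[ℂ] 𝓗) (hA : IsSelfAdjoint A) (z : ℂ) (hz : z.im ≠ 0) :
    IsUnit (A - z • (1 : 𝓗 →L[ℂ] 𝓗)) := by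
  by_contra h
  apply hz
  apply hA.im_eq_zero_of_mem_spectrum
  rw [spectrum.mem_iff]
  rw [← IsUnit.neg_iff] at h
  convert h using 2
  rw [Algebra.algebraMap_eq_smul_one]; simp

theorem aux_im (F : 𝓗 →L[ℂ] 𝓚) (A : 𝓗 →L[ℂ] 𝓗) (hA : IsSelfAdjoint A) (z : ℂ) (hz : 0 < z.im)
    (x : 𝓚) : 0 ≤ (inner ℂ x (Tz F A z x)).im := by
  have hu := aux_unit A hA z hz.ne'
  set R := Ring.inverse (A - z • (1 : 𝓗 →L[ℂ] 𝓗)) with hR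
  have h1 : (A - z • (1 : 𝓗 →L[ℂ] 𝓗)) * R = 1 := Ring.mul_inverse_cancel _ hu
  set u := R (adjoint F x) with hu'
  have h2 : A u - z • u = adjoint F x := by
    have := congrArg (fun T : 𝓗 →L[ℂ] 𝓗 => T (adjoint F x)) h1
    simpa using this
  have h3 : inner ℂ x (Tz F A z x) = inner ℂ (adjoint F x) u := by
    rw [adjoint_inner_left]; rfl
  rw [h3, ← h2, inner_sub_left, inner_smul_left, inner_self_eq_norm_sq_to_K]
  have h4 : (inner ℂ (A u) u).im = 0 := by
    have := hA.isSymmetric.im_inner_apply_self u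
    simpa using this
  rw [Complex.sub_im, h4]
  have h5 : ((starRingEnd ℂ) z * ((‖u‖ : ℝ) : ℂ) ^ 2).im = - (z.im * ‖u‖ ^ 2) := by
    rw [← Complex.ofReal_pow, Complex.im_mul_ofReal]; simp
  have h6 : 0 ≤ z.im * ‖u‖ ^ 2 := by positivity
  have h7 : ((starRingEnd ℂ) z * ((‖u‖ : ℂ)) ^ 2).im = - (z.im * ‖u‖ ^ 2) := h5
  simp only [Complex.coe_algebraMap] at *
  rw [h7]; linarith

theorem aux_resolvent (F : 𝓗 →L[ℂ] 𝓚) (A : 𝓗 →L[ℂ] 𝓗) (K : 𝓚 →L[ℂ] 𝓚) (z : ℂ)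
    (hA : IsUnit (A - z • (1 : 𝓗 →L[ℂ] 𝓗)))
    (hB : IsUnit (A + (adjoint F) ∘L K ∘L F - z • (1 : 𝓗 →L[ℂ] 𝓗))) :
    (1 + Tz F A z * K) * Tz F (A + (adjoint F) ∘L K ∘L F) z = Tz F A z := by
  unfold Tz
  have h1 := Ring.inverse_mul_cancel _ hA
  have h2 := Ring.mul_inverse_cancel _ hB
  set RA := Ring.inverse (A - z • (1 : 𝓗 →L[ℂ] 𝓗))
  set RB := Ring.inverse (A + (adjoint F) ∘L K ∘L F - z • (1 : 𝓗 →L[ℂ] 𝓗))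
  have key : RB + RA * ((adjoint F) ∘L K ∘L F) * RB = RA := by
    calc RB + RA * ((adjoint F) ∘L K ∘L F) * RB
        = (RA * (A - z • (1 : 𝓗 →L[ℂ] 𝓗))) * RB + RA * ((adjoint F) ∘L K ∘L F) * RB := by
          rw [h1, one_mul]
      _ = RA * ((A + (adjoint F) ∘L K ∘L F - z • (1 : 𝓗 →L[ℂ] 𝓗)) * RB) := by noncomm_ring
      _ = RA := by rw [h2, mul_one]
  ext x
  have := congrArg (fun T : 𝓗 →L[ℂ] 𝓗 => F (T (adjoint F x))) key
  simpa using this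

theorem aux_Tz_compact (F : 𝓗 →L[ℂ] 𝓚) (hF : IsCompactOperator F) (A : 𝓗 →L[ℂ] 𝓗) (z : ℂ) :
    IsCompactOperator (Tz F A z) :=
  hF.comp_clm (Ring.inverse (A - z • (1 : 𝓗 →L[ℂ] 𝓗)) ∘L (adjoint F))

theorem aux_selfAdjoint (F : 𝓗 →L[ℂ] 𝓚) (H : 𝓗 →L[ℂ] 𝓗) (hH : IsSelfAdjoint H)
    (J : 𝓚 →L[ℂ] 𝓚) (hJ : IsSelfAdjoint J) (r : ℝ) :
    IsSelfAdjoint (H + (r : ℂ) • ((adjoint F) ∘L J ∘L F)) := by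
  refine hH.add (IsSelfAdjoint.smul (by simp [IsSelfAdjoint]) ?_)
  exact hJ.adjoint_conj F

theorem aux_exists (T : 𝓚 →L[ℂ] 𝓚) (hT : IsCompactOperator T)
    (him : ∀ x, 0 ≤ (inner ℂ x (T x)).im) (J P : 𝓚 →L[ℂ] 𝓚) (hJ : IsSelfAdjoint J)
    (hP : 0 ≤ P) (hPJ : P * P = J * J) (r : ℝ) :
    ∃ s : ℝ, IsUnit (1 + T * ((s : ℂ) • P - (r : ℂ) • J)) := by
  have hPsa : IsSelfAdjoint P := IsSelfAdjoint.of_nonneg hP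
  have hU : IsUnit (1 + T * ((-Complex.I) • P - (r : ℂ) • J)) := by
    by_contra h
    obtain ⟨φ, hφ0, hφ⟩ := aux_fredholm _ (hT.comp_clm ((-Complex.I) • P - (r : ℂ) • J)) h
    set K := (-Complex.I) • P - (r : ℂ) • J with hK
    have h1 := him (K φ)
    have h2 : T (K φ) = -φ := hφ
    have hJr : (inner ℂ (J φ) φ).im = 0 := by
      simpa using hJ.isSymmetric.im_inner_apply_self φ
    have hPr : (inner ℂ (P φ) φ).im = 0 := by
      simpa using hPsa.isSymmetric.im_inner_apply_self φ
    have hKφ : K φ = (-Complex.I) • P φ - (r : ℂ) • J φ := by simp [hK]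
    rw [h2, inner_neg_right, hKφ, inner_sub_left, inner_smul_left, inner_smul_left] at h1
    simp [hJr] at h1
    have hQ := CFC.sqrt_mul_sqrt_self P hP
    have hQsa : IsSelfAdjoint (CFC.sqrt P) := IsSelfAdjoint.of_nonneg (CFC.sqrt_nonneg P)
    have hPQ : P φ = CFC.sqrt P (CFC.sqrt P φ) := by
      conv_lhs => rw [← hQ]
      rfl
    have h3 : inner ℂ (P φ) φ = inner ℂ (CFC.sqrt P φ) (CFC.sqrt P φ) := by
      rw [hPQ]; exact hQsa.isSymmetric _ _
    rw [h3, inner_self_eq_norm_sq_to_K] at h1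
    have h4 : ‖CFC.sqrt P φ‖ ^ 2 ≤ 0 := by
      have e : (((‖CFC.sqrt P φ‖ : ℝ) : ℂ) ^ 2).re = ‖CFC.sqrt P φ‖ ^ 2 := by
        rw [← Complex.ofReal_pow, Complex.ofReal_re]
      rw [← e]
      exact h1
    have h5 : CFC.sqrt P φ = 0 := by
      have := le_antisymm h4 (by positivity)
      simpa using this
    have h6 : P φ = 0 := by rw [hPQ, h5, map_zero]
    have h7 : J φ = 0 := by
      have : inner ℂ (J φ) (J φ) = (0 : ℂ) := by
        have e1 : inner ℂ (J φ) (J φ) = inner ℂ φ (J (J φ)) := hJ.isSymmetric _ _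
        have e2 : J (J φ) = P (P φ) := by
          have := congrArg (fun S : 𝓚 →L[ℂ] 𝓚 => S φ) hPJ
          exact this.symm
        rw [e1, e2, h6]; simp
      exact inner_self_eq_zero.1 this
    apply hφ0
    rw [hKφ, h6, h7] at h2
    simpa using h2.symm
  set U := 1 + T * ((-Complex.I) • P - (r : ℂ) • J) with hUdef
  set V := Ring.inverse U
  have hVU : V * U = 1 := Ring.inverse_mul_cancel _ hU
  set C := V * (T * P) with hCdef
  have hC : IsCompactOperator C := (hT.comp_clm P).clm_comp V
  by_contra! hcon
  have hker : ∀ n : ℕ, ∃ φ : 𝓚, φ ≠ 0 ∧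
      C φ = (-((((1 / ((n : ℝ) + 1) : ℝ)) : ℂ) + Complex.I)⁻¹) • φ := by
    intro n
    set s : ℝ := 1 / ((n : ℝ) + 1)
    obtain ⟨φ, hφ0, hφ⟩ := aux_fredholm _ (hT.comp_clm ((s : ℂ) • P - (r : ℂ) • J)) (hcon s)
    refine ⟨φ, hφ0, ?_⟩
    have hne : (s : ℂ) + Complex.I ≠ 0 := by
      intro h
      have := congrArg Complex.im h
      simp at this
    have e1 : U + ((s : ℂ) + Complex.I) • (T * P) = 1 + T * ((s : ℂ) • P - (r : ℂ) • J) := by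
      rw [hUdef]
      simp only [mul_sub, mul_smul_comm]
      module
    have e2 : U φ + ((s : ℂ) + Complex.I) • T (P φ) = 0 := by
      have := congrArg (fun S : 𝓚 →L[ℂ] 𝓚 => S φ) e1
      have h' : (1 + T * ((s : ℂ) • P - (r : ℂ) • J)) φ = φ + -φ := by
        rw [← hφ]; rfl
      rw [add_neg_cancel] at h'
      rw [← h']
      exact this
    have e3 : φ + ((s : ℂ) + Complex.I) • C φ = 0 := by
      have h1 := congrArg V e2
      have h2 : V (U φ) = φ := congrArg (fun S : 𝓚 →L[ℂ] 𝓚 => S φ) hVU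
      rw [map_add, map_smul, h2, map_zero] at h1
      exact h1
    have e4 : ((s : ℂ) + Complex.I) • C φ = -φ := (neg_eq_of_add_eq_zero_right e3).symm
    rw [neg_smul, ← smul_neg, ← e4, inv_smul_smul₀ hne]
  choose v hv hCv using hker
  refine aux_eigen C hC _ ?_ v hv hCv (1 / 2) (by norm_num) ?_
  · intro m n h
    have h := add_right_cancel (inv_injective (neg_injective h))
    have h := Complex.ofReal_injective h
    simpa using h
  · intro n
    rw [norm_neg, norm_inv, one_div]
    have hs : ‖(((1 / ((n : ℝ) + 1) : ℝ)) : ℂ) + Complex.I‖ ≤ 2 := by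
      refine (norm_add_le _ _).trans ?_
      rw [Complex.norm_real, Complex.norm_I, Real.norm_of_nonneg (by positivity)]
      have : 1 / ((n : ℝ) + 1) ≤ 1 := by
        rw [div_le_one (by positivity)]
        have : (0 : ℝ) ≤ n := by positivity
        linarith
      linarith
    apply inv_anti₀ _ hs
    rw [norm_pos_iff]
    intro h
    have := congrArg Complex.im h
    simp only [Complex.add_im, Complex.ofReal_im, Complex.I_im, Complex.zero_im] at this
    norm_num at this

/-- If the direction `F* J F` is `λ`-regular for `H₀`, then so is `F* |J| F`, where
`|J| = √(J²)` is given by the continuous functional calculus. -/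
theorem abs_regular_of_regular
    (H₀ : 𝓗 →L[ℂ] 𝓗) (hH₀ : IsSelfAdjoint H₀)
    (F : 𝓗 →L[ℂ] 𝓚) (hF : IsCompactOperator F) (lam : ℝ)
    (J : 𝓚 →L[ℂ] 𝓚) (hJ : IsSelfAdjoint J)
    (hreg : IsRegularDirection F H₀ lam J) :
    IsRegularDirection F H₀ lam (CFC.sqrt (J ^ 2)) := by
  obtain ⟨r, T, hT⟩ := hreg
  set P := CFC.sqrt (J ^ 2) with hPdef
  have hP : 0 ≤ P := CFC.sqrt_nonneg _
  have hJ2 : 0 ≤ J ^ 2 := hJ.sq_nonneg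
  have hPJ : P * P = J * J := by
    rw [hPdef, CFC.sqrt_mul_sqrt_self _ hJ2, pow_two]
  have hPsa : IsSelfAdjoint P := IsSelfAdjoint.of_nonneg hP
  set A := H₀ + (r : ℂ) • ((adjoint F) ∘L J ∘L F) with hA
  have hAsa : IsSelfAdjoint A := aux_selfAdjoint F H₀ hH₀ J hJ r
  have hTc : IsCompactOperator T :=
    isCompactOperator_of_tendsto hT (Eventually.of_forall fun y => aux_Tz_compact F hF A _)
  have him : ∀ x, 0 ≤ (inner ℂ x (T x)).im := by
    intro x
    have hcont : Continuous (fun S : 𝓚 →L[ℂ] 𝓚 => (inner ℂ x (S x)).im) := by fun_prop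
    refine ge_of_tendsto ((hcont.tendsto T).comp hT) ?_
    filter_upwards [self_mem_nhdsWithin] with y hy
    exact aux_im F A hAsa _ (by simpa using hy) x
  obtain ⟨s, hs⟩ := aux_exists T hTc him J P hJ hP hPJ r
  set K := (s : ℂ) • P - (r : ℂ) • J with hK
  have hB : H₀ + (s : ℂ) • ((adjoint F) ∘L P ∘L F) = A + (adjoint F) ∘L K ∘L F := by
    ext x
    simp [hA, hK]
  have hBsa : IsSelfAdjoint (A + (adjoint F) ∘L K ∘L F) :=
    hB ▸ aux_selfAdjoint F H₀ hH₀ P hPsa s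
  refine ⟨s, Ring.inverse (1 + T * K) * T, ?_⟩
  rw [hB]
  have hlim : Tendsto (fun y : ℝ => 1 + Tz F A ((lam : ℂ) + y * Complex.I) * K) (𝓝[>] 0)
      (𝓝 (1 + T * K)) := (hT.mul_const K).const_add 1
  have hinv : Tendsto (fun y : ℝ => Ring.inverse (1 + Tz F A ((lam : ℂ) + y * Complex.I) * K))
      (𝓝[>] 0) (𝓝 (Ring.inverse (1 + T * K))) := by
    obtain ⟨u, hu⟩ := hs
    rw [← hu] at hlim ⊢
    exact (NormedRing.inverse_continuousAt u).tendsto.comp hlim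
  refine (hinv.mul hT).congr' ?_
  have hev : ∀ᶠ y : ℝ in 𝓝[>] (0 : ℝ), IsUnit (1 + Tz F A ((lam : ℂ) + y * Complex.I) * K) :=
    hlim.eventually (Units.isOpen.mem_nhds hs)
  filter_upwards [self_mem_nhdsWithin, hev] with y hy hyu
  have hz : ((lam : ℂ) + y * Complex.I).im ≠ 0 := by
    have hy0 : (0 : ℝ) < y := hy
    simpa using hy0.ne'
  rw [← aux_resolvent F A K _ (aux_unit A hAsa _ hz) (aux_unit _ hBsa _ hz), ← mul_assoc]
  rw [aux_resolvent F A K _ (aux_unit A hAsa _ hz) (aux_unit _ hBsa _ hz)]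
  rw [Ring.inverse_mul_cancel _ hyu, one_mul]
end

section
/- Let 𝓚 be a complex Hilbert space, T : 𝓚 →L[ℂ] 𝓚 a compact operator with positive imaginary part ℑT := (2i)⁻¹(T - T*) ≥ 0, J : 𝓚 →L[ℂ] 𝓚 a bounded self-adjoint operator, r ∈ ℝ, and s ∈ ℝ with s > ‖J‖. If the operator 1 + r · T · (s·1 - J) on 𝓚 is not invertible, then there exists a nonzero ψ ∈ 𝓚 such that r · √(s·1 - J) · (ℜT) · √(s·1 - J) · ψ = -ψ and (ℑT)(√(s·1 - J) ψ) = 0, where ℜT := (T + T*)/2 and √(s·1 - J) is the positive square root of the positive definite operator s·1 - J. -/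
open ContinuousLinearMap Complex

variable {𝓚 : Type*} [NormedAddCommGroup 𝓚] [InnerProductSpace ℂ 𝓚] [CompleteSpace 𝓚]

/-- If `T` is compact with positive imaginary part, `J` self-adjoint, `s > ‖J‖`, and
`1 + r T (s - J)` is not invertible, then there is a nonzero `ψ` with
`r √(s-J) (ℜT) √(s-J) ψ = -ψ` and `(ℑT)(√(s-J) ψ) = 0`. -/
theorem exists_eigenvector_of_not_isUnit
    (T : 𝓚 →L[ℂ] 𝓚) (hT : IsCompactOperator T)
    (hIm : (((2 : ℂ) * Complex.I)⁻¹ • (T - adjoint T)).IsPositive)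
    (J : 𝓚 →L[ℂ] 𝓚) (hJ : IsSelfAdjoint J)
    (r : ℝ) (s : ℝ) (hs : ‖J‖ < s)
    (h : ¬ IsUnit (1 + (r : ℂ) • (T * ((s : ℂ) • (1 : 𝓚 →L[ℂ] 𝓚) - J)))) :
    ∃ ψ : 𝓚, ψ ≠ 0 ∧
      (r : ℂ) • ((CFC.sqrt ((s : ℂ) • (1 : 𝓚 →L[ℂ] 𝓚) - J) ∘L
          ((2 : ℂ)⁻¹ • (T + adjoint T)) ∘L
          CFC.sqrt ((s : ℂ) • (1 : 𝓚 →L[ℂ] 𝓚) - J)) ψ) = -ψ ∧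
      (((2 : ℂ) * Complex.I)⁻¹ • (T - adjoint T))
        (CFC.sqrt ((s : ℂ) • (1 : 𝓚 →L[ℂ] 𝓚) - J) ψ) = 0 := by
  set A : 𝓚 →L[ℂ] 𝓚 := (s : ℂ) • (1 : 𝓚 →L[ℂ] 𝓚) - J with hA
  have hA0 : 0 ≤ A := by
    have h1 := hJ.le_algebraMap_norm_self
    have h2 : algebraMap ℝ (𝓚 →L[ℂ] 𝓚) ‖J‖ ≤ algebraMap ℝ (𝓚 →L[ℂ] 𝓚) s :=
      algebraMap_mono _ hs.le
    have h3 : algebraMap ℝ (𝓚 →L[ℂ] 𝓚) s = (s : ℂ) • (1 : 𝓚 →L[ℂ] 𝓚) := by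
      rw [Algebra.algebraMap_eq_smul_one]
      ext x
      simp
    rw [hA, sub_nonneg, ← h3]
    exact h1.trans h2
  set S : 𝓚 →L[ℂ] 𝓚 := CFC.sqrt A with hS
  have hSS : S * S = A := CFC.sqrt_mul_sqrt_self A hA0
  have hSsa : IsSelfAdjoint S := (CFC.sqrt_nonneg A).isSelfAdjoint
  have hSsymm : ∀ x y : 𝓚, inner ℂ (S x) y = inner ℂ x (S y) := by
    intro x y
    rw [← adjoint_inner_left, hSsa.adjoint_eq]
  -- Fredholm alternative
  have hK : IsCompactOperator ((r : ℂ) • (T * A)) := (hT.comp_clm A).smul (r : ℂ)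
  obtain ⟨φ, hφ0, hφ⟩ : ∃ φ : 𝓚, φ ≠ 0 ∧ (r : ℂ) • T (A φ) = -φ := by
    rcases hK.hasEigenvalue_or_mem_resolventSet (μ := (-1 : ℂ)) (by simp) with he | he
    · obtain ⟨φ, hφ⟩ := he.exists_hasEigenvector
      refine ⟨φ, hφ.2, ?_⟩
      simpa using hφ.apply_eq_smul
    · exfalso
      apply h
      rw [spectrum.mem_resolventSet_iff] at he
      have := he.neg
      simpa [add_comm] using this
  have hr : r ≠ 0 := by
    rintro rfl
    apply hφ0
    simpa using hφ.symm
  have hAS : A φ = S (S φ) := by rw [← hSS]; rfl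
  have hψ0 : S φ ≠ 0 := by
    intro h0
    apply hφ0
    rw [hAS, h0] at hφ
    simpa using hφ.symm
  have hψ : (r : ℂ) • S (T (S (S φ))) = -(S φ) := by
    rw [← hAS, ← map_smul, hφ, map_neg]
  set ψ := S φ with hψdef
  set x := S ψ with hx
  have hrin : (r : ℂ) * inner ℂ x (T x) = -((‖ψ‖ : ℂ) ^ 2) := by
    rw [hx, hSsymm, ← inner_smul_right, hψ, inner_neg_right, inner_self_eq_norm_sq_to_K]
    rfl
  have him : (inner ℂ x (T x)).im = 0 := by
    have := congrArg Complex.im hrin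
    rw [Complex.im_ofReal_mul, ← Complex.ofReal_pow, ← Complex.ofReal_neg,
      Complex.ofReal_im] at this
    exact (mul_eq_zero.mp this).resolve_left hr
  have hstar : inner ℂ x (adjoint T x) = inner ℂ x (T x) := by
    rw [adjoint_inner_right, ← inner_conj_symm]
    exact Complex.conj_eq_iff_im.mpr him
  have hP0 : inner ℂ x ((((2 : ℂ) * Complex.I)⁻¹ • (T - adjoint T)) x) = 0 := by
    rw [smul_apply, sub_apply, inner_smul_right, inner_sub_right, hstar, sub_self, mul_zero]
  have hPx : (((2 : ℂ) * Complex.I)⁻¹ • (T - adjoint T)) x = 0 := by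
    set P := ((2 : ℂ) * Complex.I)⁻¹ • (T - adjoint T)
    have hP : 0 ≤ P := (nonneg_iff_isPositive P).mpr hIm
    have hQQ := CFC.sqrt_mul_sqrt_self P hP
    have hQsa : IsSelfAdjoint (CFC.sqrt P) := (CFC.sqrt_nonneg P).isSelfAdjoint
    have hPx : P x = CFC.sqrt P (CFC.sqrt P x) := by
      conv_lhs => rw [← hQQ]
      rfl
    rw [hPx, ← adjoint_inner_left, hQsa.adjoint_eq, inner_self_eq_zero] at hP0
    rw [hPx, hP0, map_zero]
  refine ⟨ψ, hψ0, ?_, hPx⟩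
  have hTT : T x = adjoint T x := by
    rw [smul_apply, smul_eq_zero] at hPx
    rcases hPx with h0 | h0
    · simp at h0
    · exact sub_eq_zero.mp (by simpa using h0)
  have hRe : ((2 : ℂ)⁻¹ • (T + adjoint T)) x = T x := by
    rw [smul_apply, add_apply, ← hTT, ← two_smul ℂ (T x), smul_smul]
    simp
  rw [comp_apply, comp_apply, ← hx, hRe, hψ]
end
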